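/- Define for doubly indexed real sequences u_{m,n}, v_{m,n}: δ⁺_n w = (w_{m,n+1}−w_{m,n})/Δt, μ_n w = (w_{m,n+1}+w_{m,n})/2, δ⁺_m w = (w_{m+1,n}−w_{m,n})/Δx, δ⁻_m w = (w_{m,n}−w_{m−1,n})/Δx, δ⁽²⁾_m w = (w_{m+1,n}−2w_{m,n}+w_{m−1,n})/Δx², μ_m w = (w_{m+1,n}+w_{m,n})/2. Let A₁ = αδ⁺_n u + δ⁽²⁾_m μ_n v + μ_n(u²+v²)·μ_n v and A₂ = −αδ⁺_n v + δ⁽²⁾_m μ_n u + μ_n(u²+v²)·μ_n u (all at index (m,n)), where α ∈ ℝ. Then the identity 2(μ_n u_{m,n})·A₁ − 2(μ_n v_{m,n})·A₂ = δ⁺_n(α(u_{m,n}²+v_{m,n}²)) + δ⁺_m F̃₁ holds, where F̃₁ = 2(μ_m μ_n u_{m−1,n})(δ⁻_m μ_n v_{m,n}) − 2(δ⁻_m μ_n u_{m,n})(μ_m μ_n v_{m−1,n}). In particular, if (u,v) solves the EF DVD scheme A₁ = A₂ = 0, then δ⁺_n(α(u²+v²)) + δ⁺_m F̃₁ = 0.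 -/

import Mathlib

/-- Forward time difference. -/
noncomputable def dtp (Δt : ℝ) (w : ℤ → ℤ → ℝ) (m n : ℤ) : ℝ := (w m (n + 1) - w m n) / Δt

/-- Time average. -/
noncomputable def mun (w : ℤ → ℤ → ℝ) (m n : ℤ) : ℝ := (w m (n + 1) + w m n) / 2

/-- Forward space difference. -/
noncomputable def dxp (Δx : ℝ) (w : ℤ → ℤ → ℝ) (m n : ℤ) : ℝ := (w (m + 1) n - w m n) / Δx

/-- Backward space difference. -/
noncomputable def dxm (Δx : ℝ) (w : ℤ → ℤ → ℝ) (m n : ℤ) : ℝ := (w m n - w (m - 1) n) / Δx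

/-- Second space difference. -/
noncomputable def dx2 (Δx : ℝ) (w : ℤ → ℤ → ℝ) (m n : ℤ) : ℝ :=
  (w (m + 1) n - 2 * w m n + w (m - 1) n) / Δx ^ 2

/-- Space average. -/
noncomputable def mum (w : ℤ → ℤ → ℝ) (m n : ℤ) : ℝ := (w (m + 1) n + w m n) / 2

/-- First residual of the EF DVD scheme for NLS. -/
noncomputable def A₁ (Δx Δt α : ℝ) (u v : ℤ → ℤ → ℝ) (m n : ℤ) : ℝ :=
  α * dtp Δt u m n + dx2 Δx (mun v) m n
    + mun (fun m n => u m n ^ 2 + v m n ^ 2) m n * mun v m n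

/-- Second residual of the EF DVD scheme for NLS. -/
noncomputable def A₂ (Δx Δt α : ℝ) (u v : ℤ → ℤ → ℝ) (m n : ℤ) : ℝ :=
  -α * dtp Δt v m n + dx2 Δx (mun u) m n
    + mun (fun m n => u m n ^ 2 + v m n ^ 2) m n * mun u m n

/-- Discrete charge flux. -/
noncomputable def Ftil₁ (Δx : ℝ) (u v : ℤ → ℤ → ℝ) (m n : ℤ) : ℝ :=
  2 * mum (mun u) (m - 1) n * dxm Δx (mun v) m n
    - 2 * dxm Δx (mun u) m n * mum (mun v) (m - 1) n

/-- The discrete charge balance: the residuals, weighted by the time averages, form a total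
difference. -/
theorem charge_balance (Δx Δt α : ℝ) (u v : ℤ → ℤ → ℝ) (m n : ℤ) :
    2 * mun u m n * A₁ Δx Δt α u v m n - 2 * mun v m n * A₂ Δx Δt α u v m n
      = dtp Δt (fun m n => α * (u m n ^ 2 + v m n ^ 2)) m n
        + dxp Δx (Ftil₁ Δx u v) m n := by
  simp only [A₁, A₂, Ftil₁, dtp, mun, dxp, dxm, dx2, mum, add_sub_cancel_right, sub_add_cancel]
  ring

theorem efdvd_discrete_charge_conservation
    (Δx Δt α : ℝ) (hΔx : 0 < Δx) (hΔt : 0 < Δt) (u v : ℤ → ℤ → ℝ) :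
    (∀ m n : ℤ,
      2 * mun u m n * A₁ Δx Δt α u v m n - 2 * mun v m n * A₂ Δx Δt α u v m n
        = dtp Δt (fun m n => α * (u m n ^ 2 + v m n ^ 2)) m n
          + dxp Δx (Ftil₁ Δx u v) m n) ∧
    ((∀ m n : ℤ, A₁ Δx Δt α u v m n = 0 ∧ A₂ Δx Δt α u v m n = 0) →
      ∀ m n : ℤ,
        dtp Δt (fun m n => α * (u m n ^ 2 + v m n ^ 2)) m n
          + dxp Δx (Ftil₁ Δx u v) m n = 0) := by
  refine ⟨charge_balance Δx Δt α u v, fun h m n => ?_⟩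
  rw [← charge_balance, (h m n).1, (h m n).2]
  ring
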